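/- Under the stated assumptions on B, if ρ(B) ≤ 1 then λ3 ≤ 1/2. -/

import Mathlib

theorem sum_mul_form_le {X X' Y Y' s u v m : ℝ} (hX : 0 ≤ X) (hX' : 0 ≤ X') (hY : 0 ≤ Y)
    (hY' : 0 ≤ Y') (hs : 0 ≤ s) (hu : 0 ≤ u) (hv : 0 ≤ v) (hm : 0 ≤ m) (hmuv : m ^ 2 ≤ u * v)
    (h : s * (u * v) ≤ X * Y) (h' : s * ((u + 1 / 2) * (v + 1 / 2)) ≤ X' * Y') :
    s * (2 * m + 1 / 2) ^ 2 ≤ (X + X') * (Y + Y') := by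
  have huv : 2 * m ≤ u + v := by
    apply abs_le_of_sq_le_sq' _ (by positivity) |>.2
    nlinarith [sq_nonneg (u - v)]
  have hm1 : s * m ^ 2 ≤ X * Y := (mul_le_mul_of_nonneg_left hmuv hs).trans h
  have hm2 : s * (m + 1 / 2) ^ 2 ≤ X' * Y' :=
    (mul_le_mul_of_nonneg_left (by nlinarith) hs).trans h'
  have hcross : 2 * (s * m * (m + 1 / 2)) ≤ X * Y' + X' * Y := by
    apply abs_le_of_sq_le_sq' _ (by positivity) |>.2
    have := mul_le_mul hm1 hm2 (by positivity) (by positivity)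
    nlinarith [sq_nonneg (X * Y' - X' * Y)]
  nlinarith

theorem sq_half_sub_le {a b : ℝ} (ha : 0 ≤ a) (hb : 0 ≤ b) (ha' : a ≤ 1 / 4) (hb' : b ≤ 1 / 4) :
    (1 / 2 - 3 / 5 * (a + b)) ^ 2 ≤ (1 / 2 - a) * (1 / 2 - b) := by
  have h1 : (a + b - 1 / 4) / 4 ≤ a * b := by nlinarith
  have h2 : 0 ≤ a * b := by positivity
  rcases le_total (a + b) (1 / 4) with h | h <;> nlinarith


theorem le_mul_of_le_endpoints {M k₀ k₁ t₀ t₁ l u y : ℝ} (hk : 0 ≤ k₁) (ht : 0 ≤ t₁)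
    (hl : M ≤ (k₀ - k₁ * l) * (t₀ + t₁ * l)) (hu : M ≤ (k₀ - k₁ * u) * (t₀ + t₁ * u))
    (hly : l ≤ y) (hyu : y ≤ u) : M ≤ (k₀ - k₁ * y) * (t₀ + t₁ * y) := by
  rcases (hly.trans hyu).eq_or_lt with rfl | hlu
  · rwa [le_antisymm hyu hly]
  · have h1 := mul_le_mul_of_nonneg_left hl (sub_nonneg.2 hyu)
    have h2 := mul_le_mul_of_nonneg_left hu (sub_nonneg.2 hly)
    have h3 : 0 ≤ (u - l) * (k₁ * t₁ * ((y - l) * (u - y))) :=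
      mul_nonneg (sub_pos.2 hlu).le
        (mul_nonneg (mul_nonneg hk ht) (mul_nonneg (sub_nonneg.2 hly) (sub_nonneg.2 hyu)))
    refine le_of_mul_le_mul_left ?_ (sub_pos.2 hlu)
    linear_combination h1 + h2 + h3

theorem sq_le_middle_edge {a b d : ℝ} (ha : 0 ≤ a) (hb : 0 ≤ b) (ha' : a ≤ 1 / 2 - d)
    (hb' : b ≤ 1 / 2 - d) (hd : 0 ≤ d) (hd' : d ≤ 2 / 5) (habd : a + b ≤ d) :
    (3 / 4 - d / 4) ^ 2 ≤
      (1 + 3 * d) * ((1 / 2 - a) * (1 / 2 - b)) * (3 / 2 - 6 / 5 * (d - (a + b))) ^ 2 := by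
  obtain ⟨y, hy⟩ : ∃ y, y = a + b := ⟨_, rfl⟩
  rw [← hy] at habd ⊢
  have hy0 : 0 ≤ y := by linarith
  have h4 : 0 ≤ a * b := by positivity
  have h5 : (1 / 2 - d) * (y - (1 / 2 - d)) ≤ a * b := by subst hy; nlinarith
  have hT : 9 / 4 - 18 / 5 * d + 18 / 5 * y ≤ (3 / 2 - 6 / 5 * (d - y)) ^ 2 := by
    nlinarith [sq_nonneg (d - y)]
  have hT0 : 0 ≤ 9 / 4 - 18 / 5 * d + 18 / 5 * y := by linarith
  have hab0 : 0 ≤ (1 / 2 - a) * (1 / 2 - b) := mul_nonneg (by linarith) (by linarith)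
  suffices h : ∃ K, K ≤ (1 / 2 - a) * (1 / 2 - b) ∧
      (3 / 4 - d / 4) ^ 2 ≤ (1 + 3 * d) * K * (9 / 4 - 18 / 5 * d + 18 / 5 * y) by
    obtain ⟨K, hK, h⟩ := h
    refine h.trans ?_
    gcongr
  have hquad : 0 ≤ (2 / 5 - d) * d := mul_nonneg (by linarith) hd
  rcases le_total y (1 / 2 - d) with hyc | hyc
  · refine ⟨1 / 4 - y / 2, by subst hy; nlinarith, ?_⟩
    have key := le_mul_of_le_endpoints (M := (3 / 4 - d / 4) ^ 2) (k₀ := (1 + 3 * d) / 4)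
      (k₁ := (1 + 3 * d) / 2) (t₀ := 9 / 4 - 18 / 5 * d) (t₁ := 18 / 5) (l := 0)
      (u := min d (1 / 2 - d)) (y := y) (by positivity) (by norm_num) (by nlinarith) ?_ hy0
      (le_min habd hyc)
    · linarith
    · rcases le_total d (1 / 4) with h | h
      · rw [min_eq_left (by linarith)]
        nlinarith
      · rw [min_eq_right (by linarith)]
        nlinarith [mul_nonneg hquad (sub_nonneg.2 h), mul_nonneg hd (sub_nonneg.2 h)]
  · refine ⟨1 / 4 - y / 2 + (1 / 2 - d) * (y - (1 / 2 - d)), by subst hy; nlinarith, ?_⟩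
    have hd4 : 1 / 4 ≤ d := by linarith
    have key := le_mul_of_le_endpoints (M := (3 / 4 - d / 4) ^ 2)
      (k₀ := (1 + 3 * d) * (1 / 4 - (1 / 2 - d) ^ 2))
      (k₁ := (1 + 3 * d) * d) (t₀ := 9 / 4 - 18 / 5 * d) (t₁ := 18 / 5) (l := 1 / 2 - d)
      (u := min d (1 - 2 * d)) (y := y) (by positivity) (by norm_num) ?_ ?_ hyc
      (le_min habd (by linarith))
    · linarith
    · nlinarith [mul_nonneg hquad (sub_nonneg.2 hd4), mul_nonneg hd (sub_nonneg.2 hd4)]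
    · rcases le_total d (1 / 3) with h | h
      · rw [min_eq_left (by linarith)]
        nlinarith [mul_nonneg (sub_nonneg.2 h) (sub_nonneg.2 hd4),
          mul_nonneg (mul_nonneg (sub_nonneg.2 h) (sub_nonneg.2 hd4)) hd]
      · rw [min_eq_right (by linarith)]
        have h6 := mul_nonneg (sub_nonneg.2 h) (sub_nonneg.2 hd')
        nlinarith [mul_nonneg h6 hd, mul_nonneg (mul_nonneg h6 hd) hd]

theorem le_outer_edge {z w d : ℝ} (hz : 0 ≤ z) (hd : 0 ≤ d) (hd' : d ≤ 2 / 5)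
    (hz' : z ≤ 1 / 2 - d) (hw : 0 ≤ w) (hzw : z + w ≤ d) :
    3 / 8 * (1 + d) ≤ (1 / 2 - z) * (d + 2 / 3) * (3 / 2 - 6 / 5 * w) ^ 2 := by
  have hT : 54 / 25 - 72 / 25 * d + 72 / 25 * z ≤ (3 / 2 - 6 / 5 * w) ^ 2 := by
    nlinarith [sq_nonneg (w - 1 / 4)]
  have hz2 : 0 ≤ (1 / 2 - z) * (d + 2 / 3) := mul_nonneg (by linarith) (by positivity)
  refine le_trans ?_ (mul_le_mul_of_nonneg_left hT hz2)
  have hquad : 0 ≤ (2 / 5 - d) * d := mul_nonneg (by linarith) hd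
  have key := le_mul_of_le_endpoints (M := 3 / 8 * (1 + d)) (k₀ := (d + 2 / 3) / 2)
      (k₁ := d + 2 / 3) (t₀ := 54 / 25 - 72 / 25 * d) (t₁ := 72 / 25) (l := 0)
      (u := min d (1 / 2 - d)) (y := z) (by positivity) (by norm_num) (by nlinarith) ?_ hz
      (le_min (by linarith) hz')
  · linarith
  · rcases le_total d (1 / 4) with h | h
    · rw [min_eq_left (by linarith)]
      nlinarith
    · rw [min_eq_right (by linarith)]
      nlinarith [mul_nonneg hquad (sub_nonneg.2 h), mul_nonneg hd (sub_nonneg.2 h)]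

theorem middle_edge_le {u₁ u₂ u₃ u₄ s₁ s₂ s₃ m : ℝ} (hu₁ : 0 ≤ u₁) (hu₄ : 0 ≤ u₄) (hs : 0 ≤ s₂)
    (hm : 0 ≤ m) (hmu : m ^ 2 ≤ u₁ * u₄) (h₁ : u₁ * u₂ ≤ s₁) (h₃ : u₃ * u₄ ≤ s₃)
    (h₁' : s₁ ≤ (u₁ + 1 / 2) * (u₂ + 1 / 2)) (h₃' : s₃ ≤ (u₃ + 1 / 2) * (u₄ + 1 / 2))
    (h : s₂ * (u₁ * u₄) ≤ (s₁ - u₁ * u₂) * (s₃ - u₃ * u₄))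
    (h' : s₂ * ((u₁ + 1 / 2) * (u₄ + 1 / 2)) ≤
      ((u₁ + 1 / 2) * (u₂ + 1 / 2) - s₁) * ((u₃ + 1 / 2) * (u₄ + 1 / 2) - s₃)) :
    s₂ * (2 * m + 1 / 2) ^ 2 ≤ (1 / 4 + (u₁ + u₂) / 2) * (1 / 4 + (u₃ + u₄) / 2) := by
  have := sum_mul_form_le (sub_nonneg.2 h₁) (sub_nonneg.2 h₁') (sub_nonneg.2 h₃)
    (sub_nonneg.2 h₃') hs hu₁ hu₄ hm hmu h h'
  linear_combination this

/-- The quadratic form of the weighted 5-cycle with vertex weights `a` and edge weights `e`. -/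
def cycleForm (a e x : Fin 5 → ℝ) : ℝ := ∑ i, (a i * x i ^ 2 + 2 * e i * (x i * x (i + 1)))

theorem cycleForm_rotate (a e x : Fin 5 → ℝ) (k : Fin 5) :
    cycleForm (fun i => a (i + k)) (fun i => e (i + k)) (fun i => x (i + k)) =
      cycleForm a e x := by
  unfold cycleForm
  rw [← Equiv.sum_comp (Equiv.addRight k) (fun i => a i * x i ^ 2 + 2 * e i * (x i * x (i + 1)))]
  simp [add_right_comm]

/-- The form exceeds `1/2` times the squared norm somewhere on every subspace of codimension 2. -/
def ExceedsHalf (a e : Fin 5 → ℝ) : Prop :=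
  ∀ p q : Fin 5 → ℝ, ∃ x : Fin 5 → ℝ, p ⬝ᵥ x = 0 ∧ q ⬝ᵥ x = 0 ∧
    1 / 2 * (x ⬝ᵥ x) < cycleForm a e x

/-- The form is bounded by the squared norm. -/
def BoundedByOne (a e : Fin 5 → ℝ) : Prop :=
  ∀ x : Fin 5 → ℝ, cycleForm a e x ≤ x ⬝ᵥ x

theorem ExceedsHalf.rotate {a e : Fin 5 → ℝ} (h : ExceedsHalf a e) (k : Fin 5) :
    ExceedsHalf (fun i => a (i + k)) (fun i => e (i + k)) := by
  intro p q
  obtain ⟨x, hp, hq, hx⟩ := h (fun i => p (i - k)) (fun i => q (i - k))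
  have hsum : ∀ r : Fin 5 → ℝ,
      r ⬝ᵥ (fun i => x (i + k)) = (fun i => r (i - k)) ⬝ᵥ x := fun r => by
    unfold dotProduct
    rw [← Equiv.sum_comp (Equiv.addRight k) (fun i => r (i - k) * x i)]
    simp
  refine ⟨fun i => x (i + k), by rw [hsum, hp], by rw [hsum, hq], ?_⟩
  rw [cycleForm_rotate, hsum]
  simpa using hx

theorem BoundedByOne.rotate {a e : Fin 5 → ℝ} (h : BoundedByOne a e) (k : Fin 5) :
    BoundedByOne (fun i => a (i + k)) (fun i => e (i + k)) := by
  intro x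
  have h1 := h (fun i => x (i - k))
  have h2 := cycleForm_rotate a e (fun i => x (i - k)) k
  simp only [add_sub_cancel_right] at h2
  rw [h2]
  refine h1.trans_eq ?_
  unfold dotProduct
  rw [← Equiv.sum_comp (Equiv.addRight k)]
  simp

theorem ExceedsHalf.edge {a e : Fin 5 → ℝ} (h : ExceedsHalf a e) (ha : ∀ i, a i < 1 / 2) :
    (1 / 2 - a 0) * (1 / 2 - a 1) < e 0 ^ 2 := by
  obtain ⟨x, hp, hq, hx⟩ := h (Pi.single 2 1) (Pi.single 4 1)
  simp only [single_one_dotProduct] at hp hq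
  simp [cycleForm, dotProduct, Fin.sum_univ_five, hp, hq] at hx
  have h0 := sub_pos.2 (ha 0)
  have h3 := mul_nonneg (sub_pos.2 (ha 3)).le (sq_nonneg (x 3))
  by_contra! hle
  have h1 := mul_pos h0 (sub_pos.2 hx)
  have h4 := mul_nonneg h0.le h3
  have h5 := mul_nonneg (sub_nonneg.2 hle) (sq_nonneg (x 1))
  have h6 := sq_nonneg ((1 / 2 - a 0) * x 0 - e 0 * x 1)
  linarith

theorem ExceedsHalf.path {a e : Fin 5 → ℝ} (h : ExceedsHalf a e) (ha : ∀ i, a i < 1 / 2) :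
    e 1 ^ 2 * ((1 / 2 - a 0) * (1 / 2 - a 3)) ≤
      (e 0 ^ 2 - (1 / 2 - a 0) * (1 / 2 - a 1)) *
        (e 2 ^ 2 - (1 / 2 - a 2) * (1 / 2 - a 3)) := by
  have hX := sub_pos.2 (h.edge ha)
  obtain ⟨X, hXe⟩ : ∃ X, X = e 0 ^ 2 - (1 / 2 - a 0) * (1 / 2 - a 1) := ⟨_, rfl⟩
  rw [← hXe] at hX ⊢
  obtain ⟨x, hp, hq, hx⟩ := h (Pi.single 4 1) ![0, X, (1 / 2 - a 0) * e 1, 0, 0]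
  simp only [single_one_dotProduct] at hp
  simp [cycleForm, dotProduct, Fin.sum_univ_five, hp] at hx hq
  have h0 := sub_pos.2 (ha 0)
  have h3 := sub_pos.2 (ha 3)
  have h1 := mul_pos (mul_pos h0 h3) (sub_pos.2 hx)
  have h4 := mul_nonneg h3.le (sq_nonneg ((1 / 2 - a 0) * x 0 - e 0 * x 1))
  have h5 := mul_nonneg h0.le (sq_nonneg ((1 / 2 - a 3) * x 3 - e 2 * x 2))
  have h6 : 0 < (1 / 2 - a 3) * X * x 1 ^ 2 +
      (1 / 2 - a 0) * (e 2 ^ 2 - (1 / 2 - a 2) * (1 / 2 - a 3)) * x 2 ^ 2 +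
      2 * ((1 / 2 - a 0) * (1 / 2 - a 3)) * (e 1 * (x 1 * x 2)) := by
    rw [hXe]
    linarith
  have h7 := mul_pos hX h6
  have hq' : X * x 1 = -((1 / 2 - a 0) * e 1 * x 2) := by linarith
  have h8 : 0 < ((1 / 2 - a 0) * x 2 ^ 2) * (X * (e 2 ^ 2 - (1 / 2 - a 2) * (1 / 2 - a 3)) -
      e 1 ^ 2 * ((1 / 2 - a 0) * (1 / 2 - a 3))) := by
    refine h7.trans_eq ?_
    linear_combination ((1 / 2 - a 3) * (X * x 1 - (1 / 2 - a 0) * e 1 * x 2) +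
      2 * ((1 / 2 - a 0) * (1 / 2 - a 3)) * (e 1 * x 2)) * hq'
  exact (sub_pos.1 (pos_of_mul_pos_right h8 (by positivity))).le

theorem BoundedByOne.edge {a e : Fin 5 → ℝ} (h : BoundedByOne a e) (ha : ∀ i, a i < 1 / 2) :
    e 0 ^ 2 ≤ (1 - a 0) * (1 - a 1) := by
  have hx := h ![e 0, 1 - a 0, 0, 0, 0]
  simp [cycleForm, dotProduct, Fin.sum_univ_five] at hx
  have h0 : 0 < 1 - a 0 := by linarith [ha 0]
  refine le_of_mul_le_mul_left ?_ h0
  linarith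

theorem BoundedByOne.path {a e : Fin 5 → ℝ} (h : BoundedByOne a e) (ha : ∀ i, a i < 1 / 2) :
    e 1 ^ 2 * ((1 - a 0) * (1 - a 3)) ≤
      ((1 - a 0) * (1 - a 1) - e 0 ^ 2) * ((1 - a 2) * (1 - a 3) - e 2 ^ 2) := by
  have h0 : 0 < 1 - a 0 := by linarith [ha 0]
  have h3 : 0 < 1 - a 3 := by linarith [ha 3]
  have hquad : ∀ t : ℝ, 0 ≤
      (1 - a 3) * ((1 - a 0) * (1 - a 1) - e 0 ^ 2) * (t * t) +
      (-2 * ((1 - a 0) * (1 - a 3) * e 1)) * t +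
      (1 - a 0) * ((1 - a 2) * (1 - a 3) - e 2 ^ 2) := by
    intro t
    have hx := h ![e 0 * t / (1 - a 0), t, 1, e 2 / (1 - a 3), 0]
    simp [cycleForm, dotProduct, Fin.sum_univ_five] at hx
    have hx' := mul_nonneg (mul_pos h0 h3).le (sub_nonneg.2 hx)
    refine hx'.trans_eq ?_
    field_simp
    ring
  have hd := discrim_le_zero hquad
  rw [discrim] at hd
  refine le_of_mul_le_mul_left ?_ (mul_pos h0 h3)
  linarith

theorem middle_edge_le_of_forms {a e : Fin 5 → ℝ} (ha : ∀ i, a i < 1 / 2)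
    (hE : ExceedsHalf a e) (hB : BoundedByOne a e) {m : ℝ} (hm : 0 ≤ m)
    (hm' : m ^ 2 ≤ (1 / 2 - a 0) * (1 / 2 - a 3)) :
    e 1 ^ 2 * (2 * m + 1 / 2) ^ 2 ≤
      (3 / 4 - (a 0 + a 1) / 2) * (3 / 4 - (a 2 + a 3) / 2) := by
  have h1 := (hE.rotate 2).edge (fun i => ha (i + 2))
  have h2 := (hB.rotate 2).edge (fun i => ha (i + 2))
  simp only [Fin.reduceAdd, zero_add] at h1 h2
  have hp := hE.path ha
  have hp' := hB.path ha
  have := middle_edge_le (u₁ := 1 / 2 - a 0) (u₂ := 1 / 2 - a 1) (u₃ := 1 / 2 - a 2)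
    (u₄ := 1 / 2 - a 3) (s₁ := e 0 ^ 2) (s₂ := e 1 ^ 2) (s₃ := e 2 ^ 2) (m := m)
    (by linarith [ha 0]) (by linarith [ha 3]) (sq_nonneg _) hm hm' (hE.edge ha).le h1.le
    (by linarith [hB.edge ha]) (by linarith) hp (by ring_nf at hp' ⊢; exact hp')
  linear_combination this

theorem three_edges_contradiction {u₀ u₁ u₂ u₃ d s₀ s₁ s₂ s₃ s₄ : ℝ} (hu₀ : 0 < u₀)
    (hu₁ : 0 < u₁) (hu₂ : 0 < u₂) (hu₃ : 0 < u₃) (hd : 0 < d)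
    (h₁ : u₁ * u₂ < s₁) (h₂ : u₂ * u₃ < s₂) (h₃ : u₃ * d < s₃) (h₄ : d * u₀ < s₄)
    (hp₀ : s₀ * (d * u₂) ≤ (s₄ - d * u₀) * (s₁ - u₁ * u₂))
    (hp₁ : s₁ * (u₀ * u₃) ≤ (s₀ - u₀ * u₁) * (s₂ - u₂ * u₃))
    (hp₂ : s₂ * (u₁ * d) ≤ (s₁ - u₁ * u₂) * (s₃ - u₃ * d))
    (hs₁ : s₁ ≤ (1 + 3 * d) * (u₁ * u₂)) (hs₃ : s₃ ≤ u₃ * (d + 2 / 3))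
    (hs₄ : s₄ ≤ u₀ * (d + 2 / 3)) : False := by
  have h12 := mul_pos hu₁ hu₂
  have hs₂ : s₂ ≤ 2 * (u₂ * u₃) := by
    have h := mul_le_mul (sub_le_sub_right hs₁ (u₁ * u₂)) (sub_le_sub_right hs₃ (u₃ * d))
      (sub_pos.2 h₃).le (by linarith [mul_pos hd h12])
    refine le_of_mul_le_mul_right ?_ (mul_pos hu₁ hd)
    linarith
  have hs₀ : s₀ ≤ 2 * (u₀ * u₁) := by
    have h := mul_le_mul (sub_le_sub_right hs₄ (d * u₀)) (sub_le_sub_right hs₁ (u₁ * u₂))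
      (sub_pos.2 h₁).le (by linarith)
    refine le_of_mul_le_mul_right ?_ (mul_pos hd hu₂)
    linarith
  have h := mul_le_mul (sub_le_sub_right hs₀ (u₀ * u₁)) (sub_le_sub_right hs₂ (u₂ * u₃))
    (sub_pos.2 h₂).le (by linarith [mul_pos hu₀ hu₁])
  have h' := mul_lt_mul_of_pos_right h₁ (mul_pos hu₀ hu₃)
  linarith

theorem middle_edge_upper {a b c d x s : ℝ} (ha : 0 ≤ a) (hb : 0 ≤ b) (hc : 0 ≤ c) (hd : 0 ≤ d)
    (ha' : a ≤ 1 / 2 - x) (hb' : b ≤ 1 / 2 - x) (hc' : c ≤ 1 / 2 - x) (hd' : d ≤ 1 / 2 - x)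
    (hx : x = a + b + c + d) (hx0 : 0 ≤ x)
    (hs : s * (2 * (1 / 2 - 3 / 5 * (a + d)) + 1 / 2) ^ 2 ≤
      (3 / 4 - (a + b) / 2) * (3 / 4 - (c + d) / 2)) :
    s ≤ (1 + 3 * x) * ((1 / 2 - b) * (1 / 2 - c)) := by
  have h := sq_le_middle_edge hb hc hb' hc' hx0 (by linarith) (by linarith)
  have hpos : 0 < (3 / 2 - 6 / 5 * (a + d)) ^ 2 := pow_pos (by linarith) 2
  refine le_of_mul_le_mul_right ?_ hpos
  rw [show x - (b + c) = a + d by linarith] at h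
  have : (3 / 4 - (a + b) / 2) * (3 / 4 - (c + d) / 2) ≤ (3 / 4 - x / 4) ^ 2 := by
    rw [hx]
    linarith [sq_nonneg (a + b - (c + d))]
  rw [show 2 * (1 / 2 - 3 / 5 * (a + d)) + 1 / 2 = 3 / 2 - 6 / 5 * (a + d) by ring] at hs
  exact hs.trans (this.trans h)

theorem outer_edge_upper {a b c x s : ℝ} (ha : 0 ≤ a) (hb : 0 ≤ b) (hc : 0 ≤ c)
    (hb' : b ≤ 1 / 2 - x) (hx : a + b + c ≤ x) (hx' : x ≤ 2 / 5)
    (hs : s * (2 * (1 / 2 - 3 / 5 * (a + c)) + 1 / 2) ^ 2 ≤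
      (3 / 4 - (a + b) / 2) * (3 / 4 - (1 / 2 - x + c) / 2)) :
    s ≤ (1 / 2 - b) * (x + 2 / 3) := by
  have h := le_outer_edge (w := a + c) hb (by linarith) hx' hb' (by linarith) (by linarith)
  have hpos : 0 < (3 / 2 - 6 / 5 * (a + c)) ^ 2 := pow_pos (by linarith) 2
  refine le_of_mul_le_mul_right ?_ hpos
  have : (3 / 4 - (a + b) / 2) * (3 / 4 - (1 / 2 - x + c) / 2) ≤ 3 / 4 * ((1 + x) / 2) :=
    mul_le_mul (by linarith) (by linarith) (by linarith) (by norm_num)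
  rw [show 2 * (1 / 2 - 3 / 5 * (a + c)) + 1 / 2 = 3 / 2 - 6 / 5 * (a + c) by ring] at hs
  linarith

theorem not_exceedsHalf_of_le {a e : Fin 5 → ℝ} (ha0 : ∀ i, 0 ≤ a i) (ha : ∀ i, a i < 1 / 2)
    (hsum : ∑ i, a i = 1 / 2) (hmax : ∀ i, a i ≤ a 4) (hB : BoundedByOne a e) :
    ¬ ExceedsHalf a e := by
  intro hE
  have hE1 := (hE.rotate 1).edge (fun i => ha (i + 1))
  have hE2 := (hE.rotate 2).edge (fun i => ha (i + 2))
  have hE3 := (hE.rotate 3).edge (fun i => ha (i + 3))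
  have hE4 := (hE.rotate 4).edge (fun i => ha (i + 4))
  have hP1 := hE.path ha
  have hP0 := (hE.rotate 4).path (fun i => ha (i + 4))
  have hP2 := (hE.rotate 1).path (fun i => ha (i + 1))
  have hM1 := middle_edge_le_of_forms ha hE hB (m := 1 / 2 - 3 / 5 * (a 0 + a 3))
  have hM3 := middle_edge_le_of_forms (fun i => ha (i + 2)) (hE.rotate 2) (hB.rotate 2)
    (m := 1 / 2 - 3 / 5 * (a 2 + a 0))
  have hM4 := middle_edge_le_of_forms (fun i => ha (i + 3)) (hE.rotate 3) (hB.rotate 3)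
    (m := 1 / 2 - 3 / 5 * (a 1 + a 3))
  simp only [Fin.reduceAdd, zero_add] at hE1 hE2 hE3 hE4 hP0 hP2 hM3 hM4
  obtain ⟨d, hd⟩ : ∃ d, d = 1 / 2 - a 4 := ⟨_, rfl⟩
  have ha4 : a 4 = 1 / 2 - d := by linarith
  rw [← hd] at hE3 hE4 hP0 hP2
  rw [ha4] at hM3 hM4
  simp only [Fin.sum_univ_five] at hsum
  have hd0 : 0 < d := by linarith [ha 4]
  have n0 := ha0 0
  have n1 := ha0 1
  have n2 := ha0 2
  have n3 := ha0 3
  have m0 : a 0 ≤ 1 / 2 - d := ha4 ▸ hmax 0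
  have m1 : a 1 ≤ 1 / 2 - d := ha4 ▸ hmax 1
  have m2 : a 2 ≤ 1 / 2 - d := ha4 ▸ hmax 2
  have m3 : a 3 ≤ 1 / 2 - d := ha4 ▸ hmax 3
  have hd' : d = a 0 + a 1 + a 2 + a 3 := by linarith
  have k0 : a 0 ≤ 1 / 4 := by linarith
  have k1 : a 1 ≤ 1 / 4 := by linarith
  have k2 : a 2 ≤ 1 / 4 := by linarith
  have k3 : a 3 ≤ 1 / 4 := by linarith
  replace hM1 := hM1 (by linarith) (sq_half_sub_le n0 n3 k0 k3)
  replace hM3 := hM3 (by linarith) (sq_half_sub_le n2 n0 k2 k0)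
  replace hM4 := hM4 (by linarith) (by
    rw [add_comm (a 1)]
    exact sq_half_sub_le n3 n1 k3 k1)
  exact three_edges_contradiction (sub_pos.2 (ha 0)) (sub_pos.2 (ha 1)) (sub_pos.2 (ha 2))
    (sub_pos.2 (ha 3)) hd0 hE1 hE2 hE3 hE4 hP0 hP1 hP2
    (middle_edge_upper n0 n1 n2 n3 m0 m1 m2 m3 hd' hd0.le hM1)
    (outer_edge_upper n2 n3 n0 m3 (by linarith) (by linarith) hM3)
    (outer_edge_upper n1 n0 n3 m0 (by linarith) (by linarith)
      (by rw [add_comm (a 3) (1 / 2 - d)] at hM4; linarith))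

theorem not_exceedsHalf {a e : Fin 5 → ℝ} (ha0 : ∀ i, 0 ≤ a i) (ha : ∀ i, a i < 1 / 2)
    (hsum : ∑ i, a i = 1 / 2) (hB : BoundedByOne a e) : ¬ ExceedsHalf a e := by
  intro hE
  obtain ⟨k, hk⟩ := Finite.exists_max a
  refine not_exceedsHalf_of_le (fun i => ha0 (i + (k - 4))) (fun i => ha (i + (k - 4))) ?_
    (fun i => ?_) (hB.rotate (k - 4)) (hE.rotate (k - 4))
  · rw [← hsum]
    exact Equiv.sum_comp (Equiv.addRight (k - 4)) a
  · simpa using hk _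

open Matrix in
theorem dotProduct_eigenvectorUnitary_mulVec {n : Type*} [Fintype n] [DecidableEq n]
    {A : Matrix n n ℝ} (hA : A.IsHermitian) (y : n → ℝ) :
    let x := (hA.eigenvectorUnitary : Matrix n n ℝ) *ᵥ y
    x ⬝ᵥ x = y ⬝ᵥ y ∧ x ⬝ᵥ A *ᵥ x = ∑ i, hA.eigenvalues i * y i ^ 2 := by
  intro x
  have hU : (hA.eigenvectorUnitary : Matrix n n ℝ)ᵀ * hA.eigenvectorUnitary = 1 :=
    Unitary.coe_star_mul_self hA.eigenvectorUnitary
  have hx : ∀ v : n → ℝ, x ⬝ᵥ v = y ⬝ᵥ (hA.eigenvectorUnitary : Matrix n n ℝ)ᵀ *ᵥ v := by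
    intro v
    simp only [x]
    rw [mulVec_transpose, dotProduct_comm, dotProduct_mulVec, dotProduct_comm]
  constructor
  · rw [hx, mulVec_mulVec, hU, one_mulVec]
  · have hspec : (hA.eigenvectorUnitary : Matrix n n ℝ)ᵀ * A * hA.eigenvectorUnitary =
        diagonal hA.eigenvalues := by
      conv_lhs => enter [1, 2]; rw [hA.spectral_theorem]
      rw [Unitary.conjStarAlgAut_apply]
      change (hA.eigenvectorUnitary : Matrix n n ℝ)ᵀ * (_ * _ *
        (hA.eigenvectorUnitary : Matrix n n ℝ)ᵀ) * _ = _
      simp only [Matrix.mul_assoc, hU]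
      simp only [← Matrix.mul_assoc, hU, Matrix.one_mul, Matrix.mul_one]
      rfl
    rw [hx, mulVec_mulVec, mulVec_mulVec, hspec]
    simp only [dotProduct, mulVec_diagonal]
    exact Finset.sum_congr rfl fun i _ => by ring

open Matrix in
theorem dotProduct_mulVec_le_of_spectralRadius_le_one {n : Type*} [Fintype n] [DecidableEq n]
    {A : Matrix n n ℝ} (hA : A.IsHermitian) (hr : spectralRadius ℝ A ≤ 1) (x : n → ℝ) :
    x ⬝ᵥ A *ᵥ x ≤ x ⬝ᵥ x := by
  have heig : ∀ i, hA.eigenvalues i ≤ 1 := fun i => by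
    have h : (‖hA.eigenvalues i‖₊ : ENNReal) ≤ 1 :=
      (le_iSup₂ (f := fun k (_ : k ∈ spectrum ℝ A) => (‖k‖₊ : ENNReal)) _
        (hA.eigenvalues_mem_spectrum_real i)).trans hr
    have h' : ‖hA.eigenvalues i‖ ≤ 1 := by exact_mod_cast h
    exact (le_abs_self _).trans h'
  obtain ⟨y, rfl⟩ : ∃ y, (hA.eigenvectorUnitary : Matrix n n ℝ) *ᵥ y = x :=
    ⟨star (hA.eigenvectorUnitary : Matrix n n ℝ) *ᵥ x, by
      rw [mulVec_mulVec, mul_eq_one_comm.1 (Unitary.coe_star_mul_self _), one_mulVec]⟩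
  obtain ⟨h1, h2⟩ := dotProduct_eigenvectorUnitary_mulVec hA y
  rw [h1, h2]
  refine Finset.sum_le_sum fun i _ => ?_
  nlinarith [heig i, sq_nonneg (y i)]

open Matrix in
theorem exists_lt_dotProduct_mulVec {n : Type*} [Fintype n] [DecidableEq n]
    {A : Matrix n n ℝ} (hA : A.IsHermitian) {c : ℝ}
    (hc : 3 ≤ Fintype.card {i // c < hA.eigenvalues i}) (p q : n → ℝ) :
    ∃ x : n → ℝ, p ⬝ᵥ x = 0 ∧ q ⬝ᵥ x = 0 ∧ c * (x ⬝ᵥ x) < x ⬝ᵥ A *ᵥ x := by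
  let S := {i // c < hA.eigenvalues i}
  let ext : (S → ℝ) →ₗ[ℝ] (n → ℝ) := Function.ExtendByZero.linearMap ℝ Subtype.val
  let f : (S → ℝ) →ₗ[ℝ] (n → ℝ) := (hA.eigenvectorUnitary : Matrix n n ℝ).mulVecLin ∘ₗ ext
  let g : (S → ℝ) →ₗ[ℝ] (Fin 2 → ℝ) := (Matrix.of ![p, q]).mulVecLin ∘ₗ f
  have hker : g.ker ≠ ⊥ := LinearMap.ker_ne_bot_of_finrank_lt (by
    simp only [Module.finrank_fintype_fun_eq_card, Fintype.card_fin]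
    exact hc)
  obtain ⟨z, hz, hz0⟩ := Submodule.exists_mem_ne_zero_of_ne_bot hker
  have hgz : g z = 0 := hz
  obtain ⟨h1, h2⟩ := dotProduct_eigenvectorUnitary_mulVec hA (ext z)
  refine ⟨f z, congrFun hgz 0, congrFun hgz 1, ?_⟩
  change c * (((hA.eigenvectorUnitary : Matrix n n ℝ) *ᵥ ext z) ⬝ᵥ
      ((hA.eigenvectorUnitary : Matrix n n ℝ) *ᵥ ext z)) <
    ((hA.eigenvectorUnitary : Matrix n n ℝ) *ᵥ ext z) ⬝ᵥ
      A *ᵥ ((hA.eigenvectorUnitary : Matrix n n ℝ) *ᵥ ext z)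
  have hin : ∀ i : S, ext z i = z i := fun i => Subtype.val_injective.extend_apply z _ i
  have hout : ∀ i, ¬ c < hA.eigenvalues i → ext z i = 0 := fun i hi =>
    Function.extend_apply' z _ i fun ⟨j, hj⟩ => hi (hj ▸ j.2)
  rw [h1.trans (Finset.sum_congr rfl fun i _ => (sq _).symm), h2, Finset.mul_sum]
  obtain ⟨j, hj⟩ := Function.ne_iff.1 hz0
  refine Finset.sum_lt_sum (fun i _ => ?_) ⟨j, Finset.mem_univ _, ?_⟩
  · by_cases hi : c < hA.eigenvalues i
    · exact mul_le_mul_of_nonneg_right hi.le (sq_nonneg _)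
    · simp [hout i hi]
  · rw [hin]
    exact mul_lt_mul_of_pos_right j.2 (pow_two_pos_of_ne_zero hj)


/-- Pattern C: under the stated assumptions on `B`, if `ρ(B) ≤ 1` then the
third largest eigenvalue of `B` is at most 1/2. -/
theorem stmt_16
    (b11 b12 b13 b22 b24 b33 b35 b44 b45 b55 : ℝ)
    (hb22n : 0 ≤ b22) (hb44n : 0 ≤ b44)
    (htr : b11 + b22 + b33 + b44 + b55 = 1/2)
    (h2211 : b22 ≤ b11) (h2233 : b22 ≤ b33) (h2244 : b22 ≤ b44) (h2255 : b22 ≤ b55)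
    (hb11 : 0 < b11) (hb11u : b11 < 1/2)
    (hb4411 : b44 ≤ b11) (hb44u : b44 < 1/2)
    (hb33 : 0 < b33) (hb33u : b33 < 1/2)
    (hb55 : 0 < b55) (hb55u : b55 < 1/2)
    (hb12 : 0 < b12) (hb13 : 0 < b13) (hb24 : 0 < b24) (hb35 : 0 < b35) (hb45 : 0 < b45)
    (B : Matrix (Fin 5) (Fin 5) ℝ)
    (hB : B = !![b11, b12, b13, 0, 0;
                 b12, b22, 0, b24, 0;
                 b13, 0, b33, 0, b35;
                 0, b24, 0, b44, b45;
                 0, 0, b35, b45, b55])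
    (hnos : ¬ ∃ Q : Matrix (Fin 5) (Fin 5) ℝ, Q.transpose * Q = 1 ∧
        ∀ i j, 0 < (Q.transpose * B * Q) i j)
    (l1 l2 l3 l4 l5 : ℝ)
    (hord1 : l1 ≥ l2) (hord2 : l2 ≥ l3) (hord3 : l3 ≥ l4) (hord4 : l4 ≥ l5)
    (heig : B.charpoly.roots = {l1, l2, l3, l4, l5})
    (hρ : spectralRadius ℝ B ≤ 1) :
    l3 ≤ 1/2 := by
  by_contra! hl
  have hA : B.IsHermitian := by
    rw [hB, Matrix.IsHermitian, Matrix.conjTranspose_eq_transpose_of_trivial]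
    ext i j
    fin_cases i <;> fin_cases j <;> rfl
  have hcard : 3 ≤ Fintype.card {i // 1 / 2 < hA.eigenvalues i} := by
    have h1 : ((B.charpoly.roots.filter (1 / 2 < ·)).card : ℕ) =
        Fintype.card {i // 1 / 2 < hA.eigenvalues i} := by
      rw [hA.roots_charpoly_eq_eigenvalues, Multiset.filter_map, Multiset.card_map,
        Fintype.card_subtype]
      rfl
    rw [← h1, heig]
    have h3 : ({l1, l2, l3} : Multiset ℝ) ≤ {l1, l2, l3, l4, l5} :=
      Multiset.cons_le_cons _ (Multiset.cons_le_cons _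
        (Multiset.cons_le_cons _ (Multiset.zero_le _)))
    refine Multiset.card_le_card (Multiset.le_filter.2 ⟨h3, ?_⟩)
    simp only [Multiset.insert_eq_cons, Multiset.mem_cons, Multiset.mem_singleton]
    rintro _ (rfl | rfl | rfl) <;> linarith
  let a : Fin 5 → ℝ := ![b11, b22, b44, b55, b33]
  let e : Fin 5 → ℝ := ![b12, b24, b45, b35, b13]
  have hform : ∀ x : Fin 5 → ℝ, cycleForm a e ![x 0, x 1, x 3, x 4, x 2] = x ⬝ᵥ B.mulVec x := by
    intro x
    simp [cycleForm, a, e, hB, Matrix.mulVec, dotProduct, Fin.sum_univ_five]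
    ring
  have hnorm : ∀ x : Fin 5 → ℝ, (![x 0, x 1, x 3, x 4, x 2] : Fin 5 → ℝ) ⬝ᵥ
      ![x 0, x 1, x 3, x 4, x 2] = x ⬝ᵥ x := by
    intro x
    simp [dotProduct, Fin.sum_univ_five]
    ring
  refine not_exceedsHalf (a := a) (e := e) ?_ ?_ ?_ ?_ ?_
  · simp [Fin.forall_fin_succ, a]
    exact ⟨hb11.le, hb22n, hb44n, hb55.le, hb33.le⟩
  · simp only [one_div] at *
    simp [Fin.forall_fin_succ, a]
    exact ⟨hb11u, h2211.trans_lt hb11u, hb44u, hb55u, hb33u⟩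
  · simp [Fin.sum_univ_five, a]
    linarith
  · intro y
    have h := dotProduct_mulVec_le_of_spectralRadius_le_one hA hρ ![y 0, y 1, y 4, y 2, y 3]
    rw [← hform, ← hnorm] at h
    have hy : (![y 0, y 1, y 2, y 3, y 4] : Fin 5 → ℝ) = y := by
      ext i
      fin_cases i <;> rfl
    simpa [hy] using h
  · intro p q
    obtain ⟨x, hp, hq, hx⟩ := exists_lt_dotProduct_mulVec hA hcard
      ![p 0, p 1, p 4, p 2, p 3] ![q 0, q 1, q 4, q 2, q 3]
    refine ⟨![x 0, x 1, x 3, x 4, x 2], ?_, ?_, ?_⟩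
    · rw [← hp]
      simp [dotProduct, Fin.sum_univ_five]
      ring
    · rw [← hq]
      simp [dotProduct, Fin.sum_univ_five]
      ring
    · rwa [hform, hnorm]
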